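/- arXiv:0902.2413 — 2 statements merged into one kernel-verified Lean document; each statement's English description precedes it below -/
import Mathlib

section
/- The mean entropy is weakly upper semi-continuous: if (ϱ_j) and ϱ are exchangeable Borel probability measures on cl(Λ)^ℕ such that for every n ≥ 1 the n-th marginals ⁿϱ_j converge weakly to ⁿϱ as j → ∞, then limsup_{j→∞} R̄(ϱ_j) ≤ R̄(ϱ), where R̄(ϱ) := lim_{n→∞} (1/n)·R(ⁿϱ|λ^⊗n) ∈ [−∞,0]. -/
open MeasureTheory Real Filter Set
open scoped BigOperators ENNReal

noncomputable section

attribute [local instance] Classical.propDecidable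

abbrev Euc : Type := EuclideanSpace ℝ (Fin 3)

/-- The `n`-fold product of the normalized Lebesgue measure `λ` on `Λ`. -/
def piNormLeb (Λ : Set Euc) (n : ℕ) : Measure (Fin n → Euc) :=
  ((volume Λ) ^ n)⁻¹ • volume.restrict (Set.univ.pi fun _ => Λ)

/-- Relative entropy `R(μ|ν) = −∫ ln(dμ/dν) dμ` if `μ ≪ ν` and the integral is
well defined, and `−∞` otherwise. -/
def relEnt {X : Type*} [MeasurableSpace X] (μ ν : Measure X) : EReal :=
  if μ ≪ ν ∧ Integrable (fun x => Real.log ((μ.rnDeriv ν) x).toReal) μ then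
    (((-∫ x, Real.log ((μ.rnDeriv ν) x).toReal ∂μ) : ℝ) : EReal)
  else ⊥

/-- The `n`-th marginal of a measure on the infinite product. -/
def marg (ϱ : Measure (ℕ → Euc)) (n : ℕ) : Measure (Fin n → Euc) :=
  ϱ.map (fun ω => fun i : Fin n => ω (i : ℕ))

/-- Exchangeability: invariance under all finite permutations of the coordinates. -/
def Exchangeable (ϱ : Measure (ℕ → Euc)) : Prop :=
  ∀ σ : Equiv.Perm ℕ, (∃ n : ℕ, ∀ m : ℕ, n ≤ m → σ m = m) →
    ϱ.map (fun ω => ω ∘ σ) = ϱ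

/-- An exchangeable Borel probability measure on `cl(Λ)^ℕ`. -/
def IsExchProbOn (Λ : Set Euc) (ϱ : Measure (ℕ → Euc)) : Prop :=
  IsProbabilityMeasure ϱ ∧ Exchangeable ϱ ∧
    ϱ {ω : ℕ → Euc | ¬ ∀ i : ℕ, ω i ∈ closure Λ} = 0

/-- The relative entropy `R(ⁿϱ|λ^⊗n)` of the `n`-th marginal, with the
convention `R(⁰ϱ|λ^⊗0) := 0`. -/
def margEnt (Λ : Set Euc) (ϱ : Measure (ℕ → Euc)) (n : ℕ) : EReal :=
  if n = 0 then 0 else relEnt (marg ϱ n) (piNormLeb Λ n)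

open ProbabilityTheory InformationTheory

section Variational

variable {X : Type*} [MeasurableSpace X] {μ ν : Measure X}

/-- Measurable functions bounded in absolute value are integrable for finite measures. -/
lemma Measurable.integrable_of_abs_le [IsFiniteMeasure μ] {f : X → ℝ} (hf : Measurable f) {C : ℝ}
    (hC : ∀ x, |f x| ≤ C) : Integrable f μ :=
  .of_bound hf.aestronglyMeasurable C (ae_of_all _ hC)

lemma Measurable.integrable_exp_of_abs_le [IsFiniteMeasure μ] {f : X → ℝ} (hf : Measurable f)
    {C : ℝ} (hC : ∀ x, |f x| ≤ C) : Integrable (fun x => exp (f x)) μ := by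
  refine hf.exp.integrable_of_abs_le (C := exp C) fun x => ?_
  rw [abs_of_pos (exp_pos _)]
  exact exp_le_exp.2 ((le_abs_self _).trans (hC x))

/-- Young's inequality for `klFun` and its convex conjugate. -/
lemma mul_add_one_sub_exp_le_klFun {p : ℝ} (hp : 0 ≤ p) (t : ℝ) :
    p * t + 1 - exp t ≤ klFun p := by
  rw [klFun_apply]
  rcases hp.eq_or_lt with rfl | hp
  · simpa using (exp_pos t).le
  · have h1 := add_one_le_exp (t - log p)
    rw [exp_sub, exp_log hp, le_div_iff₀ hp] at h1
    linarith

/-- Gibbs' variational inequality. -/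
lemma integral_le_toReal_klDiv [IsProbabilityMeasure μ] [IsProbabilityMeasure ν]
    (h : klDiv μ ν ≠ ∞) {f : X → ℝ} (hf : Measurable f) {C : ℝ} (hC : ∀ x, |f x| ≤ C)
    (hexp : ∫ x, exp (f x) ∂ν ≤ 1) :
    ∫ x, f x ∂μ ≤ (klDiv μ ν).toReal := by
  obtain ⟨hac, hint⟩ := klDiv_ne_top_iff.1 h
  rw [toReal_klDiv_eq_integral_klFun hac]
  have hi : Integrable (fun x => (μ.rnDeriv ν x).toReal * f x) ν :=
    (integrable_toReal_rnDeriv_mul_iff hac).2 (hf.integrable_of_abs_le hC)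
  have he := hf.integrable_exp_of_abs_le (μ := ν) hC
  have hi1 : Integrable (fun x => (μ.rnDeriv ν x).toReal * f x + 1) ν :=
    hi.add (integrable_const 1)
  have hle : ∫ x, ((μ.rnDeriv ν x).toReal * f x + 1 - exp (f x)) ∂ν
      ≤ ∫ x, klFun (μ.rnDeriv ν x).toReal ∂ν :=
    integral_mono (hi1.sub he) ((integrable_klFun_rnDeriv_iff hac).2 hint)
      fun x => mul_add_one_sub_exp_le_klFun ENNReal.toReal_nonneg _
  rw [integral_sub hi1 he, integral_add hi (integrable_const 1),
    integral_toReal_rnDeriv_mul hac] at hle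
  simp only [integral_const, probReal_univ, smul_eq_mul, mul_one] at hle
  linarith

/-- The optimiser `log p` in the variational formula, truncated to `[-n, n]`. -/
def truncLog (n : ℕ) (p : ℝ) : ℝ := if p = 0 then -n else max (-n) (min n (log p))

lemma measurable_truncLog (n : ℕ) : Measurable (truncLog n) :=
  Measurable.ite (measurableSet_singleton 0) measurable_const
    (measurable_const.max (measurable_const.min measurable_log))

lemma abs_truncLog_le (n : ℕ) (p : ℝ) : |truncLog n p| ≤ n := by
  have hn : (0 : ℝ) ≤ n := n.cast_nonneg
  unfold truncLog
  split_ifs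
  · simp
  · exact abs_le.2 ⟨le_max_left _ _, max_le (by linarith) (min_le_left _ _)⟩

lemma mul_truncLog_add_one_sub_exp_nonneg (n : ℕ) {p : ℝ} (hp : 0 ≤ p) :
    0 ≤ p * truncLog n p + 1 - exp (truncLog n p) := by
  have hn : (0 : ℝ) ≤ n := n.cast_nonneg
  rcases hp.eq_or_lt with rfl | hp
  · simp [truncLog]
  · simp only [truncLog, hp.ne', if_false]
    set t := max (-(n : ℝ)) (min n (log p)) with ht
    have h1 : 0 ≤ (p - exp t) * t := by
      rcases le_total 0 (log p) with h | h
      · have h0 : 0 ≤ t := le_max_of_le_right (le_min hn h)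
        have h2 : t ≤ log p := max_le (by linarith) (min_le_right _ _)
        have h3 : exp t ≤ p := (exp_le_exp.2 h2).trans_eq (exp_log hp)
        exact mul_nonneg (by linarith) h0
      · have h0 : t ≤ 0 := max_le (by linarith) ((min_le_right _ _).trans h)
        have h2 : log p ≤ t := le_max_of_le_right (le_min (h.trans hn) le_rfl)
        have h3 : p ≤ exp t := (exp_log hp).symm.trans_le (exp_le_exp.2 h2)
        exact mul_nonneg_of_nonpos_of_nonpos (by linarith) h0
    have h2 := add_one_le_exp (-t)
    have h3 : exp t * (-t + 1) ≤ 1 := by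
      calc exp t * (-t + 1) ≤ exp t * exp (-t) := by gcongr
        _ = 1 := by rw [← exp_add]; simp
    nlinarith

lemma tendsto_mul_truncLog_add_one_sub_exp {p : ℝ} (hp : 0 ≤ p) :
    Tendsto (fun n : ℕ => p * truncLog n p + 1 - exp (truncLog n p)) atTop (nhds (klFun p)) := by
  rcases hp.eq_or_lt with rfl | hp
  · have h : Tendsto (fun n : ℕ => exp (-(n : ℝ))) atTop (nhds 0) :=
      tendsto_exp_neg_atTop_nhds_zero.comp tendsto_natCast_atTop_atTop
    simpa [truncLog, klFun_zero] using h.const_sub 1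
  · refine tendsto_const_nhds.congr' ?_
    obtain ⟨N, hN⟩ := exists_nat_ge |log p|
    filter_upwards [eventually_ge_atTop N] with n hn
    have h1 : |log p| ≤ n := hN.trans (by exact_mod_cast hn)
    obtain ⟨h2, h3⟩ := abs_le.1 h1
    simp only [truncLog, hp.ne', if_false, min_eq_right h3, max_eq_right h2, exp_log hp,
      klFun_apply]

/-- The variational upper bound on the Kullback-Leibler divergence, tested on bounded measurable
functions. -/
lemma klDiv_le_of_forall_measurable [IsProbabilityMeasure μ] [IsProbabilityMeasure ν] {c : ℝ}
    (H : ∀ f : X → ℝ, Measurable f → ∀ C : ℝ, (∀ x, |f x| ≤ C) →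
      ∫ x, f x ∂μ ≤ c + ∫ x, exp (f x) ∂ν - 1) :
    klDiv μ ν ≤ ENNReal.ofReal c := by
  have hac : μ ≪ ν := by
    refine Measure.AbsolutelyContinuous.mk fun A hA hνA => ?_
    by_contra hμA
    have hpos : 0 < μ.real A := ENNReal.toReal_pos hμA (measure_ne_top _ _)
    obtain ⟨t, ht⟩ := exists_nat_gt (c / μ.real A)
    rw [div_lt_iff₀ hpos] at ht
    have h := H (A.indicator fun _ => (t : ℝ)) (measurable_const.indicator hA) t fun x => by
      by_cases hx : x ∈ A <;> simp [hx]
    have h1 : ∫ x, exp (A.indicator (fun _ => (t : ℝ)) x) ∂ν = 1 := by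
      have : (fun x => exp (A.indicator (fun _ => (t : ℝ)) x)) =ᵐ[ν] fun _ => 1 := by
        filter_upwards [measure_eq_zero_iff_ae_notMem.1 hνA] with x hx
        simp [hx]
      rw [integral_congr_ae this]
      simp
    rw [h1, integral_indicator_const _ hA, smul_eq_mul] at h
    linarith
  rw [klDiv_eq_lintegral_klFun_of_ac hac]
  set p : X → ℝ := fun x => (μ.rnDeriv ν x).toReal with hp
  have hpm : Measurable p := (Measure.measurable_rnDeriv μ ν).ennreal_toReal
  have hp0 : ∀ x, 0 ≤ p x := fun x => ENNReal.toReal_nonneg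
  have htm : ∀ n, Measurable fun x => truncLog n (p x) := fun n => (measurable_truncLog n).comp hpm
  set G : ℕ → X → ℝ := fun n x => p x * truncLog n (p x) + 1 - exp (truncLog n (p x)) with hG
  have hGm : ∀ n, Measurable (G n) := fun n =>
    ((hpm.mul (htm n)).add_const 1).sub (htm n).exp
  have hlim : ∀ x, liminf (fun n => ENNReal.ofReal (G n x)) atTop
      = ENNReal.ofReal (klFun (p x)) := fun x =>
    (ENNReal.tendsto_ofReal (tendsto_mul_truncLog_add_one_sub_exp (hp0 x))).liminf_eq
  have hbound : ∀ n, ∫⁻ x, ENNReal.ofReal (G n x) ∂ν ≤ ENNReal.ofReal c := fun n => by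
    have hi : Integrable (fun x => p x * truncLog n (p x)) ν :=
      (integrable_toReal_rnDeriv_mul_iff hac).2
        ((htm n).integrable_of_abs_le fun x => abs_truncLog_le n (p x))
    have he := (htm n).integrable_exp_of_abs_le (μ := ν) fun x => abs_truncLog_le n (p x)
    have hi1 : Integrable (fun x => p x * truncLog n (p x) + 1) ν := hi.add (integrable_const 1)
    have hGi : Integrable (G n) ν := hi1.sub he
    rw [← ofReal_integral_eq_lintegral_ofReal hGi
      (ae_of_all _ fun x => mul_truncLog_add_one_sub_exp_nonneg n (hp0 x))]
    refine ENNReal.ofReal_le_ofReal ?_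
    have h := H _ (htm n) n fun x => abs_truncLog_le n (p x)
    rw [hG, integral_sub hi1 he, integral_add hi (integrable_const 1),
      integral_toReal_rnDeriv_mul hac]
    simp only [integral_const, probReal_univ, smul_eq_mul, mul_one]
    linarith
  calc ∫⁻ x, ENNReal.ofReal (klFun (p x)) ∂ν
      = ∫⁻ x, liminf (fun n => ENNReal.ofReal (G n x)) atTop ∂ν := by simp_rw [hlim]
    _ ≤ liminf (fun n => ∫⁻ x, ENNReal.ofReal (G n x) ∂ν) atTop :=
        lintegral_liminf_le fun n => (hGm n).ennreal_ofReal
    _ ≤ liminf (fun _ : ℕ => ENNReal.ofReal c) atTop :=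
        liminf_le_liminf (Eventually.of_forall hbound)
    _ = ENNReal.ofReal c := by simp

lemma exp_sub_exp_le {s t C : ℝ} (ht : t ≤ C) : exp t - exp s ≤ exp C * |t - s| := by
  have h1 := add_one_le_exp (s - t)
  have h2 : exp t * (s - t + 1) ≤ exp s := by
    calc exp t * (s - t + 1) ≤ exp t * exp (s - t) := by gcongr
      _ = exp s := by rw [← exp_add]; simp
  calc exp t - exp s ≤ exp t * (t - s) := by linarith
    _ ≤ exp t * |t - s| := by gcongr; exact le_abs_self _
    _ ≤ exp C * |t - s| := by gcongr

/-- The variational upper bound on the Kullback-Leibler divergence, tested on bounded continuous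
functions. -/
lemma klDiv_le_of_forall_boundedContinuous [TopologicalSpace X]
    [TopologicalSpace.PseudoMetrizableSpace X] [BorelSpace X]
    [IsProbabilityMeasure μ] [IsProbabilityMeasure ν] {c : ℝ}
    (H : ∀ f : BoundedContinuousFunction X ℝ,
      ∫ x, f x ∂μ ≤ c + ∫ x, exp (f x) ∂ν - 1) :
    klDiv μ ν ≤ ENNReal.ofReal c := by
  let _ := TopologicalSpace.pseudoMetrizableSpacePseudoMetric X
  refine klDiv_le_of_forall_measurable fun f hf C hC => ?_
  have key : ∀ ε : ℝ, 0 < ε → ∫ x, f x ∂μ - (c + ∫ x, exp (f x) ∂ν - 1) ≤ (1 + exp C) * ε := by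
    intro ε hε
    obtain ⟨g, hg, -⟩ := (hf.integrable_of_abs_le (μ := μ + ν)
      hC).exists_boundedContinuous_integral_sub_le hε
    have hC0 : ∀ x, -C ≤ C := fun x => by linarith [abs_nonneg (f x), hC x]
    let k : X → ℝ := fun x => max (-C) (min C (g x))
    have hkc : Continuous k := by fun_prop
    have hkC : ∀ x, |k x| ≤ C := fun x =>
      abs_le.2 ⟨le_max_left _ _, max_le (hC0 x) (min_le_left _ _)⟩
    have hkf : ∀ x, |f x - k x| ≤ |f x - g x| := fun x => by
      obtain ⟨h1, h2⟩ := abs_le.1 (hC x)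
      have h3 : f x = max (-C) (min C (f x)) := by rw [min_eq_right h2, max_eq_right h1]
      calc |f x - k x| = |max (-C) (min C (f x)) - max (-C) (min C (g x))| := by rw [← h3]
        _ ≤ |min C (f x) - min C (g x)| := by
            simpa using abs_max_sub_max_le_max (-C) (min C (f x)) (-C) (min C (g x))
        _ ≤ |f x - g x| := by simpa using abs_min_sub_min_le_max C (f x) C (g x)
    have hd : ∀ (κ : Measure X) [IsFiniteMeasure κ], Integrable (fun x => |f x - g x|) κ :=
      fun κ _ => ((hf.integrable_of_abs_le hC).sub (g.integrable κ)).abs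
    have hdk : ∀ (κ : Measure X) [IsFiniteMeasure κ], Integrable (fun x => |f x - k x|) κ :=
      fun κ _ => ((hf.integrable_of_abs_le hC).sub (hkc.measurable.integrable_of_abs_le hkC)).abs
    have hsum : ∫ x, |f x - g x| ∂μ + ∫ x, |f x - g x| ∂ν ≤ ε := by
      rw [← integral_add_measure (hd μ) (hd ν)]
      exact hg
    have hμk : ∫ x, |f x - k x| ∂μ ≤ ∫ x, |f x - g x| ∂μ := integral_mono (hdk μ) (hd μ) hkf
    have hνk : ∫ x, |f x - k x| ∂ν ≤ ∫ x, |f x - g x| ∂ν := integral_mono (hdk ν) (hd ν) hkf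
    have hμ0 : 0 ≤ ∫ x, |f x - g x| ∂μ := integral_nonneg fun _ => abs_nonneg _
    have hν0 : 0 ≤ ∫ x, |f x - g x| ∂ν := integral_nonneg fun _ => abs_nonneg _
    have h1 : ∫ x, f x ∂μ - ∫ x, k x ∂μ ≤ ∫ x, |f x - k x| ∂μ := by
      rw [← integral_sub (hf.integrable_of_abs_le hC) (hkc.measurable.integrable_of_abs_le hkC)]
      exact integral_mono ((hf.integrable_of_abs_le hC).sub
        (hkc.measurable.integrable_of_abs_le hkC)) (hdk μ) fun x => le_abs_self _
    have h2 : ∫ x, exp (k x) ∂ν - ∫ x, exp (f x) ∂ν ≤ exp C * ∫ x, |f x - k x| ∂ν := by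
      rw [← integral_sub (hkc.measurable.integrable_exp_of_abs_le hkC)
        (hf.integrable_exp_of_abs_le hC), ← integral_const_mul]
      refine integral_mono ((hkc.measurable.integrable_exp_of_abs_le hkC).sub
        (hf.integrable_exp_of_abs_le hC)) ((hdk ν).const_mul _) fun x => ?_
      rw [abs_sub_comm]
      exact exp_sub_exp_le ((le_abs_self _).trans (hkC x))
    have h3 : ∫ x, k x ∂μ ≤ c + ∫ x, exp (k x) ∂ν - 1 :=
      H (BoundedContinuousFunction.ofNormedAddCommGroup k hkc C hkC)
    have hexp := exp_pos C
    have h4 : exp C * ∫ x, |f x - k x| ∂ν ≤ exp C * ε := by gcongr; linarith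
    linarith
  have hlim : Tendsto (fun ε : ℝ => (1 + exp C) * ε) (nhdsWithin 0 (Ioi 0)) (nhds 0) := by
    have : Tendsto (fun ε : ℝ => (1 + exp C) * ε) (nhds 0) (nhds ((1 + exp C) * 0)) :=
      (continuous_const.mul continuous_id).tendsto 0
    rw [mul_zero] at this
    exact this.mono_left nhdsWithin_le_nhds
  have := ge_of_tendsto hlim (eventually_mem_nhdsWithin.mono fun ε hε => key ε hε)
  linarith

/-- Donsker-Varadhan duality: every value below the Kullback-Leibler divergence is exceeded by the
integral of some normalised bounded continuous function. -/
lemma exists_boundedContinuous_lt_integral [TopologicalSpace X]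
    [TopologicalSpace.PseudoMetrizableSpace X] [BorelSpace X]
    [IsProbabilityMeasure μ] [IsProbabilityMeasure ν] {c : ℝ}
    (hc : ENNReal.ofReal c < klDiv μ ν) :
    ∃ f : BoundedContinuousFunction X ℝ, ∫ x, exp (f x) ∂ν ≤ 1 ∧ c < ∫ x, f x ∂μ := by
  contrapose! hc
  refine klDiv_le_of_forall_boundedContinuous fun f => ?_
  have hf : ∀ x, |f x| ≤ ‖f‖ := f.norm_coe_le_norm
  have hpos : 0 < ∫ x, exp (f x) ∂ν :=
    integral_exp_pos (f.continuous.measurable.integrable_exp_of_abs_le hf)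
  set a := ∫ x, exp (f x) ∂ν
  have h := hc (f - BoundedContinuousFunction.const X (log a)) (by
    simp only [BoundedContinuousFunction.coe_sub, Pi.sub_apply,
      BoundedContinuousFunction.const_apply, exp_sub, exp_log hpos, integral_div]
    exact (div_self hpos.ne').le)
  simp only [BoundedContinuousFunction.coe_sub, Pi.sub_apply,
    BoundedContinuousFunction.const_apply] at h
  rw [integral_sub (f.integrable μ) (integrable_const _)] at h
  simp only [integral_const, probReal_univ, smul_eq_mul, one_mul] at h
  linarith [log_le_sub_one_of_pos hpos]

/-- Weak lower semicontinuity of the Kullback-Leibler divergence in its first argument. -/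
lemma eventually_ofReal_le_klDiv [TopologicalSpace X]
    [TopologicalSpace.PseudoMetrizableSpace X] [BorelSpace X]
    [IsProbabilityMeasure μ] [IsProbabilityMeasure ν] {ι : Type*} {l : Filter ι}
    {μs : ι → Measure X} (hμs : ∀ j, IsProbabilityMeasure (μs j))
    (hweak : ∀ h : BoundedContinuousFunction X ℝ,
      Tendsto (fun j => ∫ x, h x ∂(μs j)) l (nhds (∫ x, h x ∂μ)))
    {c : ℝ} (hc : ENNReal.ofReal c < klDiv μ ν) :
    ∀ᶠ j in l, ENNReal.ofReal c ≤ klDiv (μs j) ν := by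
  obtain ⟨f, hf1, hf2⟩ := exists_boundedContinuous_lt_integral hc
  filter_upwards [(hweak f).eventually_const_lt hf2] with j hj
  by_cases htop : klDiv (μs j) ν = ∞
  · simp [htop]
  · have := hμs j
    exact ENNReal.ofReal_le_of_le_toReal (hj.le.trans
      (integral_le_toReal_klDiv htop f.continuous.measurable f.norm_coe_le_norm hf1))

/-- Relative entropy is minus the Kullback-Leibler divergence. -/
lemma relEnt_eq_neg_klDiv [IsProbabilityMeasure μ] [IsProbabilityMeasure ν] :
    relEnt μ ν = -((klDiv μ ν : ℝ≥0∞) : EReal) := by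
  by_cases h : μ ≪ ν ∧ Integrable (llr μ ν) μ
  · have h1 := toReal_klDiv_of_measure_eq h.1 (by simp : μ univ = ν univ)
    have h2 : relEnt μ ν = ((-∫ x, llr μ ν x ∂μ : ℝ) : EReal) := if_pos h
    rw [h2, ← h1, EReal.coe_neg, EReal.coe_ennreal_toReal (klDiv_ne_top_iff.2 h)]
  · have h1 : klDiv μ ν = ∞ := by
      by_contra h'
      exact h (klDiv_ne_top_iff.1 h')
    have h2 : relEnt μ ν = ⊥ := if_neg h
    simp [h1, h2]

/-- Superadditivity of the Kullback-Leibler divergence with respect to a product measure. -/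
lemma klDiv_fst_add_klDiv_snd_le {Y Z : Type*} [MeasurableSpace Y] [MeasurableSpace Z]
    [StandardBorelSpace Z] [Nonempty Z] (γ : Measure (Y × Z)) [IsProbabilityMeasure γ]
    (α : Measure Y) (β : Measure Z) [IsProbabilityMeasure α] [IsProbabilityMeasure β] :
    klDiv γ.fst α + klDiv γ.snd β ≤ klDiv γ (α.prod β) := by
  have h1 : klDiv γ (α.prod β)
      = klDiv γ.fst α + klDiv γ (γ.fst ⊗ₘ Kernel.const Y β) := by
    have := klDiv_compProd_eq_add (μ := γ.fst) (ν := α) (κ := γ.condKernel)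
      (η := Kernel.const Y β)
    rwa [γ.disintegrate, Measure.compProd_const] at this
  rw [h1]
  gcongr
  have h2 := klDiv_map_le γ (γ.fst ⊗ₘ Kernel.const Y β) measurable_snd
  have h3 : (γ.fst ⊗ₘ Kernel.const Y β).map Prod.snd = β := by
    rw [Measure.compProd_const]
    exact Measure.snd_prod
  rwa [h3] at h2

end Variational

section Marginals

lemma piNormLeb_eq_pi_cond {Λ : Set Euc} (hΛ : volume Λ ≠ ∞) (n : ℕ) :
    piNormLeb Λ n = Measure.pi fun _ => cond volume Λ := by
  have : SigmaFinite (cond (volume : Measure Euc) Λ) := by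
    by_cases h : volume Λ = 0
    · rw [cond_eq_zero_of_meas_eq_zero h]; infer_instance
    · have := cond_isProbabilityMeasure_of_finite h hΛ
      infer_instance
  refine (Measure.pi_eq fun s hs => ?_).symm
  rw [piNormLeb, volume_pi, Measure.restrict_pi_pi, Measure.smul_apply, Measure.pi_pi]
  simp only [ProbabilityTheory.cond, Measure.smul_apply, smul_eq_mul, Finset.prod_mul_distrib,
    Finset.prod_const, Finset.card_univ, Fintype.card_fin, ENNReal.inv_pow]

/-- Splitting a finite product of copies of a measure into two blocks of coordinates. -/
lemma pi_map_castAdd_natAdd {E : Type*} [MeasurableSpace E] (μ : Measure E) [SigmaFinite μ]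
    (a b : ℕ) :
    (Measure.pi fun _ : Fin (a + b) => μ).map
        (fun x => (fun i => x (Fin.castAdd b i), fun i => x (Fin.natAdd a i)))
      = (Measure.pi fun _ : Fin a => μ).prod (Measure.pi fun _ : Fin b => μ) := by
  have h1 := (measurePreserving_piCongrLeft (fun _ : Fin (a + b) => μ)
    (finSumFinEquiv (m := a) (n := b))).symm
  have h2 := measurePreserving_sumPiEquivProdPi fun _ : Fin a ⊕ Fin b => μ
  exact (h2.comp h1).map_eq

/-- The permutation of `ℕ` moving the block `[0, b)` to `[a, a + b)` and `[b, a + b)` to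
`[0, a)`. -/
def blockSwap (a b : ℕ) : Equiv.Perm ℕ where
  toFun i := if i < b then i + a else if i < a + b then i - b else i
  invFun i := if i < a then i + b else if i < a + b then i - a else i
  left_inv i := by dsimp only; split_ifs <;> omega
  right_inv i := by dsimp only; split_ifs <;> omega

variable {ϱ : Measure (ℕ → Euc)}

lemma isProbabilityMeasure_marg [IsProbabilityMeasure ϱ] (n : ℕ) :
    IsProbabilityMeasure (marg ϱ n) :=
  Measure.isProbabilityMeasure_map
    (f := fun ω : ℕ → Euc => fun i : Fin n => ω i) (by fun_prop : Measurable _).aemeasurable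

/-- For exchangeable measures, shifting the coordinates does not change the marginals. -/
lemma Exchangeable.map_shift_eq_marg (hϱ : Exchangeable ϱ) (a b : ℕ) :
    ϱ.map (fun ω => fun i : Fin b => ω (a + i)) = marg ϱ b := by
  have h := hϱ (blockSwap a b) ⟨a + b, fun m hm => by
    simp only [blockSwap, Equiv.coe_fn_mk]; split_ifs <;> omega⟩
  rw [marg]
  nth_rw 2 [← h]
  rw [Measure.map_map (by fun_prop) (by fun_prop)]
  congr 1
  ext ω i : 2
  simp [blockSwap, add_comm]

/-- Superadditivity of the divergence of the marginals of an exchangeable measure. -/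
lemma Exchangeable.klDiv_marg_add_le [IsProbabilityMeasure ϱ] (hϱ : Exchangeable ϱ)
    (μ : Measure Euc) [IsProbabilityMeasure μ] (a b : ℕ) :
    klDiv (marg ϱ a) (Measure.pi fun _ => μ) + klDiv (marg ϱ b) (Measure.pi fun _ => μ)
      ≤ klDiv (marg ϱ (a + b)) (Measure.pi fun _ => μ) := by
  have := isProbabilityMeasure_marg (ϱ := ϱ) (a + b)
  let T : (Fin (a + b) → Euc) → (Fin a → Euc) × (Fin b → Euc) :=
    fun x => (fun i => x (Fin.castAdd b i), fun i => x (Fin.natAdd a i))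
  have hT : Measurable T := by fun_prop
  have hγ : IsProbabilityMeasure ((marg ϱ (a + b)).map T) :=
    Measure.isProbabilityMeasure_map hT.aemeasurable
  have h1 : ((marg ϱ (a + b)).map T).fst = marg ϱ a := by
    rw [Measure.fst, marg, Measure.map_map hT (by fun_prop),
      Measure.map_map measurable_fst (by fun_prop)]
    rfl
  have h2 : ((marg ϱ (a + b)).map T).snd = marg ϱ b := by
    rw [← hϱ.map_shift_eq_marg a b, Measure.snd, marg, Measure.map_map hT (by fun_prop),
      Measure.map_map measurable_snd (by fun_prop)]
    rfl
  calc _ = klDiv ((marg ϱ (a + b)).map T).fst (Measure.pi fun _ => μ)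
        + klDiv ((marg ϱ (a + b)).map T).snd (Measure.pi fun _ => μ) := by rw [h1, h2]
    _ ≤ klDiv ((marg ϱ (a + b)).map T)
          ((Measure.pi fun _ => μ).prod (Measure.pi fun _ => μ)) :=
        klDiv_fst_add_klDiv_snd_le _ _ _
    _ = klDiv ((marg ϱ (a + b)).map T) ((Measure.pi fun _ => μ).map T) := by
        rw [pi_map_castAdd_natAdd]
    _ ≤ _ := klDiv_map_le _ _ hT

lemma Exchangeable.mul_klDiv_marg_le [IsProbabilityMeasure ϱ] (hϱ : Exchangeable ϱ)
    (μ : Measure Euc) [IsProbabilityMeasure μ] (k n : ℕ) :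
    k * klDiv (marg ϱ n) (Measure.pi fun _ => μ)
      ≤ klDiv (marg ϱ (k * n)) (Measure.pi fun _ => μ) := by
  induction k with
  | zero => simp
  | succ k ih =>
    rw [Nat.succ_mul, Nat.cast_succ, add_mul, one_mul]
    exact (add_le_add_left ih _).trans (hϱ.klDiv_marg_add_le μ _ _)

lemma margEnt_eq_neg_klDiv {Λ : Set Euc} (h0 : volume Λ ≠ 0) (hΛ : volume Λ ≠ ∞)
    [IsProbabilityMeasure ϱ] {n : ℕ} (hn : n ≠ 0) :
    margEnt Λ ϱ n
      = -((klDiv (marg ϱ n) (Measure.pi fun _ => cond volume Λ) : ℝ≥0∞) : EReal) := by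
  have := cond_isProbabilityMeasure_of_finite h0 hΛ
  have := isProbabilityMeasure_marg (ϱ := ϱ) n
  rw [margEnt, if_neg hn, piNormLeb_eq_pi_cond hΛ, relEnt_eq_neg_klDiv]

/-- A lower bound on the divergence of one marginal bounds the mean entropy from above. -/
lemma Exchangeable.meanEntropy_le {Λ : Set Euc} (h0 : volume Λ ≠ 0) (hΛ : volume Λ ≠ ∞)
    [IsProbabilityMeasure ϱ] (hϱ : Exchangeable ϱ) {R : EReal}
    (hR : Tendsto (fun n : ℕ => (((n : ℝ)⁻¹ : ℝ) : EReal) * margEnt Λ ϱ n) atTop (nhds R))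
    {n : ℕ} (hn : n ≠ 0) {c : ℝ}
    (hc : ENNReal.ofReal c ≤ klDiv (marg ϱ n) (Measure.pi fun _ => cond volume Λ)) :
    R ≤ ((-(c / n) : ℝ) : EReal) := by
  have := cond_isProbabilityMeasure_of_finite h0 hΛ
  have hsub : Tendsto (fun k : ℕ => k * n) atTop atTop :=
    tendsto_id.atTop_mul_const' (Nat.pos_of_ne_zero hn)
  refine le_of_tendsto (hR.comp hsub) ?_
  filter_upwards [eventually_ne_atTop 0] with k hk
  have hkn : k * n ≠ 0 := mul_ne_zero hk hn
  have hn' : (0 : ℝ) < n := by positivity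
  have hk' : (0 : ℝ) < k := by positivity
  have h1 : ((k * c : ℝ) : EReal)
      ≤ (klDiv (marg ϱ (k * n)) (Measure.pi fun _ => cond volume Λ) : ℝ≥0∞) := by
    have h2 : ENNReal.ofReal (k * c)
        ≤ klDiv (marg ϱ (k * n)) (Measure.pi fun _ => cond volume Λ) := by
      rw [ENNReal.ofReal_mul hk'.le, ENNReal.ofReal_natCast]
      exact (by gcongr : _ ≤ _).trans (hϱ.mul_klDiv_marg_le _ k n)
    calc ((k * c : ℝ) : EReal) ≤ ((max (k * c) 0 : ℝ) : EReal) := by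
          exact_mod_cast le_max_left _ _
      _ = ((ENNReal.ofReal (k * c) : ℝ≥0∞) : EReal) := (EReal.coe_ennreal_ofReal).symm
      _ ≤ _ := by exact_mod_cast h2
  simp only [Function.comp_apply]
  rw [margEnt_eq_neg_klDiv h0 hΛ hkn]
  calc ((((k * n : ℕ) : ℝ)⁻¹ : ℝ) : EReal) * _
      ≤ ((((k * n : ℕ) : ℝ)⁻¹ : ℝ) : EReal) * -((k * c : ℝ) : EReal) := by
        exact mul_le_mul_of_nonneg_left (EReal.neg_le_neg_iff.2 h1)
          (by exact_mod_cast (by positivity : (0 : ℝ) ≤ ((k * n : ℕ) : ℝ)⁻¹))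
    _ = ((-(c / n) : ℝ) : EReal) := by
        rw [← EReal.coe_neg, ← EReal.coe_mul]
        congr 1
        push_cast
        field_simp

end Marginals

theorem statement13
    (Λ : Set Euc) (hΛne : Λ.Nonempty) (hΛopen : IsOpen Λ)
    (hΛbdd : Bornology.IsBounded Λ) (hΛconn : IsConnected Λ)
    (ϱseq : ℕ → Measure (ℕ → Euc)) (hϱseq : ∀ j, IsExchProbOn Λ (ϱseq j))
    (ϱ : Measure (ℕ → Euc)) (hϱ : IsExchProbOn Λ ϱ)
    -- weak convergence of every `n`-th marginal
    (hweak : ∀ n : ℕ, 1 ≤ n → ∀ h : BoundedContinuousFunction (Fin n → Euc) ℝ,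
      Tendsto (fun j : ℕ => ∫ x, h x ∂(marg (ϱseq j) n)) atTop
        (nhds (∫ x, h x ∂(marg ϱ n))))
    -- the mean entropies (the limits exist in `[−∞,0]` by sub-additivity)
    (Rbar : ℕ → EReal) (RbarLim : EReal)
    (hRbar : ∀ j : ℕ,
      Tendsto (fun n : ℕ => (((n : ℝ)⁻¹ : ℝ) : EReal) * margEnt Λ (ϱseq j) n)
        atTop (nhds (Rbar j)))
    (hRbarLim :
      Tendsto (fun n : ℕ => (((n : ℝ)⁻¹ : ℝ) : EReal) * margEnt Λ ϱ n)
        atTop (nhds RbarLim)) :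
    Filter.limsup Rbar atTop ≤ RbarLim := by
  have h0 : volume Λ ≠ 0 := (hΛopen.measure_pos volume hΛne).ne'
  have hfin : volume Λ ≠ ∞ := hΛbdd.measure_lt_top.ne
  have hprob := cond_isProbabilityMeasure_of_finite h0 hfin
  have hp : IsProbabilityMeasure ϱ := hϱ.1
  refine ge_of_tendsto hRbarLim ?_
  filter_upwards [eventually_ne_atTop 0] with n hn
  have hpn := isProbabilityMeasure_marg (ϱ := ϱ) n
  have hn' : (0 : ℝ) < n := by positivity
  rw [margEnt_eq_neg_klDiv h0 hfin hn]
  set K := klDiv (marg ϱ n) (Measure.pi fun _ => cond volume Λ) with hK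
  refine EReal.le_of_forall_lt_iff_le.1 fun b hb => ?_
  have hlim : ∀ c : ℝ, (∀ᶠ j in atTop, ENNReal.ofReal c
      ≤ klDiv (marg (ϱseq j) n) (Measure.pi fun _ => cond volume Λ)) →
      limsup Rbar atTop ≤ ((-(c / n) : ℝ) : EReal) := fun c hc => by
    refine limsup_le_of_le (h := ?_)
    filter_upwards [hc] with j hj
    have := (hϱseq j).1
    exact (hϱseq j).2.1.meanEntropy_le h0 hfin (hRbar j) hn hj
  have hb' : b = -(-(b * n) / n) := by field_simp
  rw [hb']
  refine hlim _ ?_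
  rcases le_or_gt 0 b with hb0 | hb0
  · refine Eventually.of_forall fun j => ?_
    rw [ENNReal.ofReal_of_nonpos (by nlinarith)]
    exact zero_le
  · refine eventually_ofReal_le_klDiv (μ := marg ϱ n)
      (fun j => have := (hϱseq j).1; isProbabilityMeasure_marg n)
      (hweak n (Nat.one_le_iff_ne_zero.2 hn)) ?_
    rw [← hK]
    by_contra! hle
    have hKtop : K ≠ ∞ := ne_top_of_le_ne_top ENNReal.ofReal_ne_top hle
    have hle' : K.toReal ≤ -(b * n) :=
      ENNReal.toReal_le_of_le_ofReal (by nlinarith) hle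
    rw [← EReal.coe_toReal (x := (K : EReal)) (by simpa using hKtop) (by simp),
      EReal.toReal_coe_ennreal, ← EReal.coe_neg, ← EReal.coe_mul, EReal.coe_lt_coe_iff,
      inv_mul_lt_iff₀ hn'] at hb
    linarith
end
end

section
/- Let Λ ⊂ ℝ^D be a nonempty bounded connected open set and assume hypotheses (H1)–(H4) on U, with U ≥ 0. For N ≥ 2 define the quasi pair-specific ground state energy ε̃_g(N) := min{ N⁻²·Σ_{1≤i<j≤N} U(q_i,q_j) : (q₁,…,q_N) ∈ cl(Λ)^N }. Then ε̃_g(N+1) ≥ (N²/((N+1)(N−1)))·ε̃_g(N) for every N ≥ 2 (in particular N ↦ ε̃_g(N) is nondecreasing, and strictly increasing at every N with ε̃_g(N) > 0), and ε̃_g(N) → ε_g := min{ ⟨ρ,ρ⟩ : ρ a Borel probability measure on cl(Λ) } as N → ∞. -/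
open MeasureTheory Real Filter Set
open scoped BigOperators ENNReal

noncomputable section

variable (D : ℕ)

abbrev EucD (D : ℕ) : Type := EuclideanSpace ℝ (Fin D)

/-- Interaction energy `I_N(q) = ∑_{i<j} U(q_i, q_j)` (extended-real valued). -/
def interactionE (U : EucD D → EucD D → ℝ≥0∞) (N : ℕ) (q : Fin N → EucD D) : ℝ≥0∞ :=
  ∑ i : Fin N, ∑ j : Fin N, if (i : ℕ) < (j : ℕ) then U (q i) (q j) else 0

/-- The bilinear pairing `⟨ρ,ρ'⟩ = ∬ ½ U(x,y) ρ(dx) ρ'(dy)`. -/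
def pairingE (U : EucD D → EucD D → ℝ≥0∞) (ρ ρ' : Measure (EucD D)) : ℝ≥0∞ :=
  ∫⁻ x, ∫⁻ y, U x y / 2 ∂ρ' ∂ρ

/-- A Borel probability measure concentrated on `cl(Λ)`. -/
def IsProbOn (Λ : Set (EucD D)) (ρ : Measure (EucD D)) : Prop :=
  IsProbabilityMeasure ρ ∧ ρ ((closure Λ)ᶜ) = 0

/-- `ε_g`, the infimum of `⟨ρ,ρ⟩` over Borel probability measures on `cl(Λ)`. -/
def groundEnergyE (U : EucD D → EucD D → ℝ≥0∞) (Λ : Set (EucD D)) : ℝ≥0∞ :=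
  ⨅ ρ ∈ {ρ : Measure (EucD D) | IsProbOn D Λ ρ}, pairingE D U ρ ρ

/-- Hypotheses (H1)–(H4) on the pair interaction `U`. -/
structure HypUE (U : EucD D → EucD D → ℝ≥0∞) (Λ : Set (EucD D)) : Prop where
  /-- (H1) Symmetry. -/
  symm : ∀ x ∈ closure Λ, ∀ y ∈ closure Λ, U x y = U y x
  /-- (H2) Lower semicontinuity on `cl(Λ)×cl(Λ)`. -/
  lsc : LowerSemicontinuousOn (fun p : EucD D × EucD D => U p.1 p.2) (closure Λ ×ˢ closure Λ)
  /-- (H3) Sublevel set regularity. -/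
  sublevel : ∀ δ : ℝ, 0 < δ →
    0 < volume {p : EucD D × EucD D | p.1 ∈ Λ ∧ p.2 ∈ Λ ∧
      U p.1 p.2 < (⨅ x ∈ closure Λ, ⨅ y ∈ closure Λ, U x y) + ENNReal.ofReal δ}
  /-- (H4) Local square integrability. -/
  locL2 : ∀ x ∈ Λ, ∃ r : ℝ, 0 < r ∧ (∫⁻ y in Metric.ball x r ∩ Λ, (U x y) ^ 2) < ⊤

/-- The pair-specific ground state energy
`ε_g(N) = min{ I_N(q)/(N(N−1)) : q ∈ cl(Λ)^N }`. -/
def pairGroundEnergy (U : EucD D → EucD D → ℝ≥0∞) (Λ : Set (EucD D)) (N : ℕ) : ℝ≥0∞ :=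
  ⨅ q ∈ {q : Fin N → EucD D | ∀ i, q i ∈ closure Λ},
    interactionE D U N q / ((N * (N - 1) : ℕ) : ℝ≥0∞)

/-- The quasi pair-specific ground state energy
`ε̃_g(N) = min{ I_N(q)/N² : q ∈ cl(Λ)^N }`. -/
def quasiPairGroundEnergy (U : EucD D → EucD D → ℝ≥0∞) (Λ : Set (EucD D)) (N : ℕ) : ℝ≥0∞ :=
  ⨅ q ∈ {q : Fin N → EucD D | ∀ i, q i ∈ closure Λ},
    interactionE D U N q / ((N ^ 2 : ℕ) : ℝ≥0∞)

/-! ### Pair sums -/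

/-- The sum of `f i j` over the pairs `i < j` of `Fin N`. -/
def pairSum {N : ℕ} (f : Fin N → Fin N → ℝ≥0∞) : ℝ≥0∞ :=
  ∑ i : Fin N, ∑ j : Fin N, if (i : ℕ) < (j : ℕ) then f i j else 0

theorem pairSum_swap {N : ℕ} (f : Fin N → Fin N → ℝ≥0∞) (hf : ∀ i j, f i j = f j i) :
    (∑ i : Fin N, ∑ j : Fin N, if (j : ℕ) < (i : ℕ) then f i j else 0) = pairSum f := by
  rw [Finset.sum_comm, pairSum]
  exact Finset.sum_congr rfl fun i _ => Finset.sum_congr rfl fun j _ => by rw [hf]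

theorem two_mul_pairSum_const_le {N : ℕ} (e : ℝ≥0∞) :
    2 * pairSum (fun _ _ : Fin N => e) ≤ (N : ℝ≥0∞) ^ 2 * e := by
  rw [two_mul]
  nth_rw 2 [← pairSum_swap _ fun _ _ => rfl]
  rw [pairSum, ← Finset.sum_add_distrib]
  simp_rw [← Finset.sum_add_distrib]
  calc _ ≤ ∑ _i : Fin N, ∑ _j : Fin N, e := by
        refine Finset.sum_le_sum fun i _ => Finset.sum_le_sum fun j _ => ?_
        rcases lt_trichotomy (i : ℕ) (j : ℕ) with h | h | h
        · simp [h, h.not_gt]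
        · simp [h]
        · simp [h, h.not_gt]
    _ = _ := by simp [sq, mul_assoc]

theorem sum_sum_min_le {N : ℕ} (f : Fin N → Fin N → ℝ≥0∞) (hf : ∀ i j, f i j = f j i)
    (M : ℝ≥0∞) : ∑ i, ∑ j, min (f i j) M ≤ 2 * pairSum f + N * M := by
  have hM : (N : ℝ≥0∞) * M = ∑ i : Fin N, ∑ j : Fin N, if i = j then M else 0 := by simp
  rw [two_mul, hM]
  nth_rw 2 [← pairSum_swap f hf]
  rw [pairSum, ← Finset.sum_add_distrib, ← Finset.sum_add_distrib]
  simp_rw [← Finset.sum_add_distrib]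
  refine Finset.sum_le_sum fun i _ => Finset.sum_le_sum fun j _ => ?_
  rcases lt_trichotomy i j with h | h | h
  · have h' : (i : ℕ) < j := h
    simp [h', h'.not_gt, h.ne]
  · simp [h]
  · have h' : (j : ℕ) < i := h
    simp [h', h'.not_gt, h.ne']

theorem sum_succAbove_eq_sum_ite {N : ℕ} (k : Fin (N + 1)) (f : Fin (N + 1) → ℝ≥0∞) :
    ∑ i : Fin N, f (k.succAbove i) = ∑ i, if i = k then 0 else f i := by
  rw [Fin.sum_univ_succAbove _ k]
  simp [Fin.succAbove_ne]

/-- Deleting each index in turn counts every pair `N - 1` times. -/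
theorem sum_pairSum_succAbove {N : ℕ} (f : Fin (N + 1) → Fin (N + 1) → ℝ≥0∞) :
    ∑ k : Fin (N + 1), pairSum (fun i j => f (k.succAbove i) (k.succAbove j)) =
      ((N - 1 : ℕ) : ℝ≥0∞) * pairSum f := by
  have h1 : ∀ k : Fin (N + 1), pairSum (fun i j => f (k.succAbove i) (k.succAbove j)) =
      ∑ i, ∑ j, if i = k ∨ j = k then 0 else if (i : ℕ) < (j : ℕ) then f i j else 0 := by
    intro k
    let g : Fin (N + 1) → Fin (N + 1) → ℝ≥0∞ := fun a b => if (a : ℕ) < (b : ℕ) then f a b else 0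
    have hg : ∀ i j : Fin N, (if (i : ℕ) < (j : ℕ) then
        f (k.succAbove i) (k.succAbove j) else 0) = g (k.succAbove i) (k.succAbove j) := by
      intro i j
      have : (i : ℕ) < (j : ℕ) ↔ (k.succAbove i : ℕ) < (k.succAbove j : ℕ) :=
        (k.succAbove_lt_succAbove_iff (i := i) (j := j)).symm
      simp only [this, g]
    change (∑ i : Fin N, ∑ j : Fin N, _) = ∑ i, ∑ j, if i = k ∨ j = k then 0 else g i j
    rw [Finset.sum_congr rfl fun i _ => (Finset.sum_congr rfl fun j _ => hg i j).trans
        (sum_succAbove_eq_sum_ite k (g (k.succAbove i))),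
      sum_succAbove_eq_sum_ite k fun a => ∑ b, if b = k then 0 else g a b]
    refine Finset.sum_congr rfl fun i _ => ?_
    by_cases hi : i = k <;> simp [hi]
  rw [Finset.sum_congr rfl fun k _ => h1 k, Finset.sum_comm, pairSum, Finset.mul_sum]
  refine Finset.sum_congr rfl fun i _ => ?_
  rw [Finset.sum_comm, Finset.mul_sum]
  refine Finset.sum_congr rfl fun j _ => ?_
  by_cases hij : (i : ℕ) < (j : ℕ)
  · have hne : i ≠ j := fun h => by simp [h] at hij
    have hcard : (Finset.univ.filter fun k : Fin (N + 1) => ¬ (i = k ∨ j = k)).card = N - 1 := by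
      have : (Finset.univ.filter fun k : Fin (N + 1) => ¬ (i = k ∨ j = k)) = {i, j}ᶜ := by
        ext k; simp [eq_comm]
      rw [this, Finset.card_compl, Finset.card_pair hne]
      simp
    simp only [if_pos hij]
    simp_rw [← ite_not (_ = _ ∨ _ = _)]
    rw [← Finset.sum_filter, Finset.sum_const, hcard, nsmul_eq_mul]
  · simp [hij]

/-! ### Minimal energies -/

/-- The infimum of `N⁻² ∑_{i<j} V (q i) (q j)` over configurations in `X`. -/
def minEnergy {X : Type*} (V : X → X → ℝ≥0∞) (N : ℕ) : ℝ≥0∞ :=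
  ⨅ q : Fin N → X, pairSum (fun i j => V (q i) (q j)) / (N : ℝ≥0∞) ^ 2

theorem sq_mul_minEnergy_le {X : Type*} (V : X → X → ℝ≥0∞) {N : ℕ}
    (q : Fin N → X) : (N : ℝ≥0∞) ^ 2 * minEnergy V N ≤ pairSum (fun i j => V (q i) (q j)) := by
  calc _ ≤ (N : ℝ≥0∞) ^ 2 * (pairSum (fun i j => V (q i) (q j)) / (N : ℝ≥0∞) ^ 2) := by
        gcongr; exact iInf_le _ q
    _ ≤ _ := ENNReal.mul_div_le

theorem ratio_mul_minEnergy_le {X : Type*} (V : X → X → ℝ≥0∞) {N : ℕ} (hN : 2 ≤ N) :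
    (((N ^ 2 : ℕ) : ℝ≥0∞) / (((N + 1) * (N - 1) : ℕ) : ℝ≥0∞)) * minEnergy V N ≤
      minEnergy V (N + 1) := by
  refine le_iInf fun q => ?_
  have hsum : ((N + 1 : ℕ) : ℝ≥0∞) * ((N : ℝ≥0∞) ^ 2 * minEnergy V N) ≤
      ((N - 1 : ℕ) : ℝ≥0∞) * pairSum (fun i j => V (q i) (q j)) := by
    rw [← sum_pairSum_succAbove]
    calc _ = ∑ _k : Fin (N + 1), (N : ℝ≥0∞) ^ 2 * minEnergy V N := by simp
      _ ≤ _ := Finset.sum_le_sum fun k _ =>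
        sq_mul_minEnergy_le V fun i => q (k.succAbove i)
  have h1 : ((N - 1 : ℕ) : ℝ≥0∞) ≠ 0 := by
    rw [Nat.cast_ne_zero]; omega
  have h2 : ((N + 1 : ℕ) : ℝ≥0∞) ≠ 0 := by
    rw [Nat.cast_ne_zero]; omega
  rw [ENNReal.le_div_iff_mul_le (Or.inl (pow_ne_zero _ h2))
    (Or.inl (ENNReal.pow_ne_top (ENNReal.natCast_ne_top _)))]
  rw [← ENNReal.mul_le_mul_iff_right h1 (ENNReal.natCast_ne_top _)]
  refine le_trans (le_of_eq ?_) hsum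
  rw [ENNReal.div_eq_inv_mul, Nat.cast_mul, Nat.cast_pow]
  rw [ENNReal.mul_inv (Or.inr (ENNReal.natCast_ne_top _)) (Or.inr h1)]
  have e1 := ENNReal.mul_inv_cancel h1 (ENNReal.natCast_ne_top _)
  have e2 := ENNReal.mul_inv_cancel h2 (ENNReal.natCast_ne_top _)
  calc _ = (((N - 1 : ℕ) : ℝ≥0∞) * ((N - 1 : ℕ) : ℝ≥0∞)⁻¹) *
        (((N + 1 : ℕ) : ℝ≥0∞) * ((N + 1 : ℕ) : ℝ≥0∞)⁻¹) *
        (((N + 1 : ℕ) : ℝ≥0∞) * ((N : ℝ≥0∞) ^ 2 * minEnergy V N)) := by ring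
    _ = _ := by rw [e1, e2]; ring

theorem one_lt_sq_div {N : ℕ} (hN : 2 ≤ N) :
    (1 : ℝ≥0∞) < ((N ^ 2 : ℕ) : ℝ≥0∞) / (((N + 1) * (N - 1) : ℕ) : ℝ≥0∞) := by
  have h0 : (N + 1) * (N - 1) ≠ 0 := by
    have : N - 1 ≠ 0 := by omega
    positivity
  rw [ENNReal.lt_div_iff_mul_lt (Or.inl (Nat.cast_ne_zero.2 h0))
    (Or.inl (ENNReal.natCast_ne_top _)), one_mul, Nat.cast_lt]
  obtain ⟨m, rfl⟩ := Nat.exists_eq_add_of_le hN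
  have : 2 + m - 1 = m + 1 := by omega
  rw [this]; nlinarith

theorem minEnergy_le_succ {X : Type*} (V : X → X → ℝ≥0∞) {N : ℕ} (hN : 2 ≤ N) :
    minEnergy V N ≤ minEnergy V (N + 1) :=
  calc minEnergy V N = 1 * minEnergy V N := (one_mul _).symm
    _ ≤ _ := by gcongr; exact (one_lt_sq_div hN).le
    _ ≤ _ := ratio_mul_minEnergy_le V hN

theorem minEnergy_lt_succ {X : Type*} (V : X → X → ℝ≥0∞) {N : ℕ} (hN : 2 ≤ N)
    (hpos : 0 < minEnergy V N) (hfin : minEnergy V N ≠ ⊤) :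
    minEnergy V N < minEnergy V (N + 1) :=
  calc minEnergy V N = 1 * minEnergy V N := (one_mul _).symm
    _ < _ := (ENNReal.mul_lt_mul_iff_left hpos.ne' hfin).2 (one_lt_sq_div hN)
    _ ≤ _ := ratio_mul_minEnergy_le V hN

/-- Averaging the energy of a random configuration bounds the minimal energy. -/
theorem minEnergy_le_lintegral {X : Type*} [MeasurableSpace X] {V : X → X → ℝ≥0∞}
    (hV : Measurable fun p : X × X => V p.1 p.2) (μ : Measure X) [IsProbabilityMeasure μ]
    {N : ℕ} (hN : N ≠ 0) : minEnergy V N ≤ ∫⁻ x, ∫⁻ y, V x y / 2 ∂μ ∂μ := by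
  set e : ℝ≥0∞ := ∫⁻ p : X × X, V p.1 p.2 ∂(μ.prod μ) with he
  have hhalf : ∫⁻ x, ∫⁻ y, V x y / 2 ∂μ ∂μ = e / 2 := by
    rw [he, lintegral_prod _ hV.aemeasurable]
    simp_rw [div_eq_mul_inv]
    rw [← lintegral_mul_const' _ _ (by simp)]
    refine lintegral_congr fun x => ?_
    rw [lintegral_mul_const' _ _ (by simp)]
  have hpair : ∀ i j : Fin N, i ≠ j →
      ∫⁻ q : Fin N → X, V (q i) (q j) ∂(Measure.pi fun _ => μ) = e := by
    intro i j hij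
    have hind : ProbabilityTheory.IndepFun (fun q : Fin N → X => q i) (fun q => q j)
        (Measure.pi fun _ => μ) :=
      (ProbabilityTheory.iIndepFun_pi (μ := fun _ : Fin N => μ) (X := fun _ => id)
        (fun _ => aemeasurable_id)).indepFun hij
    have hmap := (ProbabilityTheory.indepFun_iff_map_prod_eq_prod_map_map
      (measurable_pi_apply i).aemeasurable (measurable_pi_apply j).aemeasurable).1 hind
    have hev : ∀ k : Fin N, (Measure.pi fun _ : Fin N => μ).map (fun q => q k) = μ := fun k =>
      (measurePreserving_eval (fun _ : Fin N => μ) k).map_eq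
    rw [hev, hev] at hmap
    rw [he, ← hmap, lintegral_map hV (by fun_prop)]
  have hint : ∫⁻ q : Fin N → X, pairSum (fun i j => V (q i) (q j)) ∂(Measure.pi fun _ => μ) =
      pairSum (fun _ _ : Fin N => e) := by
    have hm : ∀ i j : Fin N, Measurable fun q : Fin N → X => V (q i) (q j) := fun i j =>
      hV.comp (by fun_prop : Measurable fun q : Fin N → X => (q i, q j))
    have hm' : ∀ i j : Fin N, Measurable fun q : Fin N → X =>
        if (i : ℕ) < (j : ℕ) then V (q i) (q j) else 0 := by
      intro i j
      by_cases h : (i : ℕ) < (j : ℕ) <;> simp [h, hm]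
    simp only [pairSum]
    rw [lintegral_finsetSum _ fun i _ => Finset.measurable_sum _ fun j _ => hm' i j]
    refine Finset.sum_congr rfl fun i _ => ?_
    rw [lintegral_finsetSum _ fun j _ => hm' i j]
    refine Finset.sum_congr rfl fun j _ => ?_
    by_cases h : (i : ℕ) < (j : ℕ)
    · simp only [if_pos h]
      exact hpair i j fun h' => by simp [h'] at h
    · simp [h]
  have hle : (N : ℝ≥0∞) ^ 2 * minEnergy V N ≤ pairSum (fun _ _ : Fin N => e) := by
    rw [← hint]
    calc _ = ∫⁻ _q : Fin N → X, (N : ℝ≥0∞) ^ 2 * minEnergy V N ∂(Measure.pi fun _ => μ) := by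
          simp
      _ ≤ _ := lintegral_mono fun q => sq_mul_minEnergy_le V q
  rw [hhalf, ENNReal.le_div_iff_mul_le (by simp) (by simp), mul_comm]
  have hN0 : (N : ℝ≥0∞) ^ 2 ≠ 0 := pow_ne_zero _ (Nat.cast_ne_zero.2 hN)
  rw [← ENNReal.mul_le_mul_iff_right hN0 (by finiteness)]
  calc _ = 2 * ((N : ℝ≥0∞) ^ 2 * minEnergy V N) := by ring
    _ ≤ 2 * pairSum (fun _ _ : Fin N => e) := by gcongr
    _ ≤ _ := two_mul_pairSum_const_le e

/-! ### Weak limits -/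

theorem lintegral_le_liminf_lintegral_of_lowerSemicontinuous {Ω : Type*} [TopologicalSpace Ω]
    [MeasurableSpace Ω] [OpensMeasurableSpace Ω] [HasOuterApproxClosed Ω]
    {μ : ProbabilityMeasure Ω} {μs : ℕ → ProbabilityMeasure Ω}
    (hμ : Tendsto μs atTop (nhds μ)) {F : Ω → ℝ≥0∞} (hF : LowerSemicontinuous F)
    (hfin : ∀ x, F x ≠ ⊤) :
    ∫⁻ x, F x ∂(μ : Measure Ω) ≤ atTop.liminf fun n => ∫⁻ x, F x ∂(μs n : Measure Ω) := by
  have hcake : ∀ ν : Measure Ω,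
      ∫⁻ x, F x ∂ν = ∫⁻ t in Ioi (0 : ℝ), ν {x | t < (F x).toReal} := by
    intro ν
    rw [← lintegral_eq_lintegral_meas_lt ν (Eventually.of_forall fun x => ENNReal.toReal_nonneg)
      hF.measurable.ennreal_toReal.aemeasurable]
    exact lintegral_congr fun x => (ENNReal.ofReal_toReal (hfin x)).symm
  simp_rw [hcake]
  calc _ ≤ ∫⁻ t in Ioi (0 : ℝ), atTop.liminf
        (fun n => (μs n : Measure Ω) {x | t < (F x).toReal}) := by
        refine setLIntegral_mono' measurableSet_Ioi fun t ht => ?_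
        refine ProbabilityMeasure.le_liminf_measure_open_of_tendsto hμ ?_
        have : {x | t < (F x).toReal} = F ⁻¹' Ioi (ENNReal.ofReal t) := by
          ext x
          simp only [mem_ofPred_eq, mem_preimage, mem_Ioi]
          exact (ENNReal.ofReal_lt_iff_lt_toReal (le_of_lt ht) (hfin x)).symm
        rw [this]
        exact hF.isOpen_preimage _
    _ ≤ _ := lintegral_liminf_le fun n => Antitone.measurable fun s t hst =>
        measure_mono fun x hx => lt_of_le_of_lt hst hx

/-- The empirical measure of a configuration. -/
def empiricalMeasure {X : Type*} [MeasurableSpace X] {N : ℕ} (q : Fin N → X) : Measure X :=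
  (N : ℝ≥0∞)⁻¹ • ∑ i, Measure.dirac (q i)

theorem isProbabilityMeasure_empiricalMeasure {X : Type*} [MeasurableSpace X] {N : ℕ}
    (hN : N ≠ 0) (q : Fin N → X) : IsProbabilityMeasure (empiricalMeasure q) := by
  refine ⟨?_⟩
  simp only [empiricalMeasure, Measure.smul_apply, Measure.finsetSum_apply, measure_univ,
    Finset.sum_const, Finset.card_univ, Fintype.card_fin, nsmul_eq_mul, mul_one, smul_eq_mul]
  exact ENNReal.inv_mul_cancel (Nat.cast_ne_zero.2 hN) (ENNReal.natCast_ne_top _)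

theorem lintegral_empiricalMeasure {X : Type*} [MeasurableSpace X] {N : ℕ} (q : Fin N → X)
    {f : X → ℝ≥0∞} (hf : Measurable f) :
    ∫⁻ x, f x ∂(empiricalMeasure q) = (N : ℝ≥0∞)⁻¹ * ∑ i, f (q i) := by
  rw [empiricalMeasure, lintegral_smul_measure, lintegral_finsetSum_measure, smul_eq_mul]
  simp_rw [lintegral_dirac' _ hf]

theorem lintegral_prod_empiricalMeasure_min_le {X : Type*} [MeasurableSpace X] {N : ℕ}
    (hN : N ≠ 0) (q : Fin N → X) {V : X → X → ℝ≥0∞}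
    (hV : Measurable fun p : X × X => V p.1 p.2) (hsymm : ∀ x y, V x y = V y x) (M : ℝ≥0∞) :
    ∫⁻ p, min (V p.1 p.2) M ∂((empiricalMeasure q).prod (empiricalMeasure q)) ≤
      2 * (pairSum (fun i j => V (q i) (q j)) / (N : ℝ≥0∞) ^ 2) + M / N := by
  have := isProbabilityMeasure_empiricalMeasure hN q
  have hm : Measurable fun p : X × X => min (V p.1 p.2) M := hV.min measurable_const
  rw [lintegral_prod _ hm.aemeasurable, lintegral_empiricalMeasure q hm.lintegral_prod_right']
  have hinner : ∀ x, ∫⁻ y, min (V x y) M ∂(empiricalMeasure q) =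
      (N : ℝ≥0∞)⁻¹ * ∑ j, min (V x (q j)) M := fun x =>
    lintegral_empiricalMeasure q (hm.comp measurable_prodMk_left)
  simp only [hinner]
  rw [← Finset.mul_sum]
  have hN0 : (N : ℝ≥0∞) ≠ 0 := Nat.cast_ne_zero.2 hN
  calc _ ≤ (N : ℝ≥0∞)⁻¹ * ((N : ℝ≥0∞)⁻¹ *
        (2 * pairSum (fun i j => V (q i) (q j)) + N * M)) := by
        gcongr
        exact sum_sum_min_le _ (fun i j => hsymm _ _) M
    _ = 2 * (pairSum (fun i j => V (q i) (q j)) * ((N : ℝ≥0∞)⁻¹) ^ 2) +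
        M * (N : ℝ≥0∞)⁻¹ * (N * (N : ℝ≥0∞)⁻¹) := by ring
    _ = _ := by
        rw [ENNReal.mul_inv_cancel hN0 (ENNReal.natCast_ne_top _), mul_one,
          div_eq_mul_inv, div_eq_mul_inv, ENNReal.inv_pow]

/-- Compactness: configurations of asymptotically bounded energy have a limiting probability
measure whose energy obeys the same bound. -/
theorem exists_probabilityMeasure_lintegral_le {X : Type*} [MetricSpace X] [CompactSpace X]
    [MeasurableSpace X] [BorelSpace X] {V : X → X → ℝ≥0∞}
    (hV : LowerSemicontinuous fun p : X × X => V p.1 p.2) (hsymm : ∀ x y, V x y = V y x)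
    {c : ℝ≥0∞} (q : ∀ n : ℕ, Fin (n + 2) → X)
    (hq : ∀ n : ℕ, pairSum (fun i j => V (q n i) (q n j)) / ((n + 2 : ℕ) : ℝ≥0∞) ^ 2 ≤
      c + ((n + 2 : ℕ) : ℝ≥0∞)⁻¹) :
    ∃ μ : ProbabilityMeasure X,
      ∫⁻ x, ∫⁻ y, V x y / 2 ∂(μ : Measure X) ∂(μ : Measure X) ≤ c := by
  have hVm := hV.measurable
  let ν : ℕ → ProbabilityMeasure X := fun n =>
    ⟨empiricalMeasure (q n), isProbabilityMeasure_empiricalMeasure (by omega) _⟩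
  obtain ⟨μ, φ, hφ, hlim⟩ := CompactSpace.tendsto_subseq ν
  refine ⟨μ, ?_⟩
  have hprod : Tendsto (fun n => (ν (φ n)).prod (ν (φ n))) atTop (nhds (μ.prod μ)) :=
    (ProbabilityMeasure.continuous_prod.tendsto (μ, μ)).comp (hlim.prodMk_nhds hlim)
  have hinv : Tendsto (fun n => ((φ n + 2 : ℕ) : ℝ≥0∞)⁻¹) atTop (nhds 0) :=
    ENNReal.tendsto_inv_nat_nhds_zero.comp
      ((tendsto_add_atTop_nat 2).comp hφ.tendsto_atTop)
  have htrunc : ∀ M : ℕ, ∫⁻ p : X × X, min (V p.1 p.2) M ∂((μ : Measure X).prod μ) ≤ 2 * c := by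
    intro M
    have hlsc : LowerSemicontinuous fun p : X × X => min (V p.1 p.2) (M : ℝ≥0∞) :=
      hV.inf lowerSemicontinuous_const
    refine (lintegral_le_liminf_lintegral_of_lowerSemicontinuous hprod hlsc fun p =>
      ne_top_of_le_ne_top (ENNReal.natCast_ne_top M) (min_le_right _ _)).trans ?_
    have hbd : Tendsto (fun n => 2 * (c + ((φ n + 2 : ℕ) : ℝ≥0∞)⁻¹) +
        (M : ℝ≥0∞) * ((φ n + 2 : ℕ) : ℝ≥0∞)⁻¹) atTop (nhds (2 * (c + 0) + M * 0)) :=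
      (ENNReal.Tendsto.const_mul (tendsto_const_nhds.add hinv) (Or.inr (by simp))).add
        (ENNReal.Tendsto.const_mul hinv (Or.inr (by simp)))
    rw [add_zero, mul_zero, add_zero] at hbd
    rw [← hbd.liminf_eq]
    refine liminf_le_liminf (Eventually.of_forall fun n => ?_)
    refine (lintegral_prod_empiricalMeasure_min_le (by omega) (q (φ n)) hVm hsymm M).trans ?_
    rw [div_eq_mul_inv (M : ℝ≥0∞)]
    gcongr
    exact hq (φ n)
  have hfull : ∫⁻ p : X × X, V p.1 p.2 ∂((μ : Measure X).prod μ) ≤ 2 * c := by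
    have hsup : ∀ p : X × X, V p.1 p.2 = ⨆ M : ℕ, min (V p.1 p.2) (M : ℝ≥0∞) := fun p => by
      have := inf_iSup_eq (V p.1 p.2) fun M : ℕ => (M : ℝ≥0∞)
      rw [ENNReal.iSup_natCast, inf_top_eq] at this
      exact this
    rw [lintegral_congr hsup, lintegral_iSup (fun M => hVm.min measurable_const)
      fun M M' h p => min_le_min le_rfl (by exact_mod_cast h)]
    exact iSup_le htrunc
  rw [lintegral_prod _ hVm.aemeasurable] at hfull
  simp_rw [div_eq_mul_inv]
  simp_rw [fun x => lintegral_mul_const' (μ := (μ : Measure X)) (2⁻¹ : ℝ≥0∞) (V x) (by simp)]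
  rw [lintegral_mul_const' _ _ (by simp), ← div_eq_mul_inv]
  exact ENNReal.div_le_of_le_mul' hfull

theorem tendsto_minEnergy {X : Type*} [MetricSpace X] [CompactSpace X]
    [MeasurableSpace X] [BorelSpace X] {V : X → X → ℝ≥0∞}
    (hV : LowerSemicontinuous fun p : X × X => V p.1 p.2) (hsymm : ∀ x y, V x y = V y x) :
    Tendsto (minEnergy V) atTop (nhds (⨅ μ : ProbabilityMeasure X,
      ∫⁻ x, ∫⁻ y, V x y / 2 ∂(μ : Measure X) ∂(μ : Measure X))) := by
  have hmono : Monotone fun n => minEnergy V (n + 2) :=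
    monotone_nat_of_le_succ fun n => minEnergy_le_succ V (by omega)
  rw [← tendsto_add_atTop_iff_nat 2]
  convert tendsto_atTop_iSup hmono using 2
  refine le_antisymm ?_ (iSup_le fun n => le_iInf fun μ =>
    minEnergy_le_lintegral hV.measurable _ (by omega))
  set c := ⨆ n, minEnergy V (n + 2) with hc
  rcases eq_or_ne c ⊤ with htop | htop
  · simp [htop]
  have hex : ∀ n : ℕ, ∃ q : Fin (n + 2) → X,
      pairSum (fun i j => V (q i) (q j)) / ((n + 2 : ℕ) : ℝ≥0∞) ^ 2 <
        c + ((n + 2 : ℕ) : ℝ≥0∞)⁻¹ := by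
    intro n
    refine iInf_lt_iff.1 ((le_iSup (fun n => minEnergy V (n + 2)) n).trans_lt ?_)
    exact ENNReal.lt_add_right htop (ENNReal.inv_ne_zero.2 (ENNReal.natCast_ne_top _))
  choose q hq using hex
  obtain ⟨μ, hμ⟩ := exists_probabilityMeasure_lintegral_le hV hsymm q fun n => (hq n).le
  exact (iInf_le _ μ).trans hμ

/-! ### Transfer to `closure Λ` -/

theorem quasiPairGroundEnergy_eq_minEnergy {D : ℕ} (U : EucD D → EucD D → ℝ≥0∞)
    (Λ : Set (EucD D)) (N : ℕ) :
    quasiPairGroundEnergy D U Λ N = minEnergy (fun x y : closure Λ => U x y) N := by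
  refine le_antisymm (le_iInf fun q => ?_) (le_iInf₂ fun q hq => ?_)
  · refine (iInf₂_le (fun i => (q i : EucD D)) fun i => (q i).2).trans (le_of_eq ?_)
    simp [interactionE, pairSum]
  · refine (iInf_le _ fun i => (⟨q i, hq i⟩ : closure Λ)).trans (le_of_eq ?_)
    simp [interactionE, pairSum]

theorem pairingE_map_subtype {D : ℕ} (U : EucD D → EucD D → ℝ≥0∞)
    (Λ : Set (EucD D)) (μ : Measure (closure Λ)) :
    pairingE D U (μ.map (↑)) (μ.map (↑)) = ∫⁻ x, ∫⁻ y, U x y / 2 ∂μ ∂μ := by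
  have he : MeasurableEmbedding ((↑) : closure Λ → EucD D) :=
    MeasurableEmbedding.subtype_coe isClosed_closure.measurableSet
  simp only [pairingE, he.lintegral_map]

theorem groundEnergyE_eq_iInf {D : ℕ} (U : EucD D → EucD D → ℝ≥0∞) (Λ : Set (EucD D)) :
    groundEnergyE D U Λ = ⨅ μ : ProbabilityMeasure (closure Λ),
      ∫⁻ x, ∫⁻ y, U x y / 2 ∂(μ : Measure (closure Λ)) ∂(μ : Measure (closure Λ)) := by
  have he : MeasurableEmbedding ((↑) : closure Λ → EucD D) :=
    MeasurableEmbedding.subtype_coe isClosed_closure.measurableSet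
  refine le_antisymm (le_iInf fun μ => ?_) (le_iInf₂ fun ρ hρ => ?_)
  · rw [← pairingE_map_subtype]
    refine iInf₂_le ((μ : Measure (closure Λ)).map ((↑) : closure Λ → EucD D))
      ⟨Measure.isProbabilityMeasure_map he.measurable.aemeasurable, ?_⟩
    rw [he.map_apply]
    simp
  · obtain ⟨hprob, hcompl⟩ := hρ
    have hmap : (ρ.comap ((↑) : closure Λ → EucD D)).map ((↑) : closure Λ → EucD D) = ρ := by
      rw [he.map_comap, Subtype.range_coe, Measure.restrict_eq_self_of_ae_mem]
      exact hcompl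
    have hprob' : IsProbabilityMeasure (ρ.comap ((↑) : closure Λ → EucD D)) := by
      refine ⟨?_⟩
      rw [← preimage_univ (f := ((↑) : closure Λ → EucD D)), ← he.map_apply, hmap, measure_univ]
    refine (iInf_le _ ⟨_, hprob'⟩).trans (le_of_eq ?_)
    rw [ProbabilityMeasure.coe_mk, ← pairingE_map_subtype, hmap]

/-- A relation holding almost everywhere from each point of a non-null set admits sequences all
of whose pairs are related. -/
theorem exists_seq_pairwise_of_ae {α : Type*} [MeasurableSpace α] {μ : Measure α} {A : Set α}
    (hA : μ A ≠ 0) {R : α → α → Prop} (hR : ∀ x ∈ A, ∀ᵐ y ∂μ, y ∈ A → R x y) :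
    ∃ f : ℕ → α, (∀ n, f n ∈ A) ∧ ∀ m n, m < n → R (f m) (f n) := by
  refine exists_seq_of_forall_finset_exists (· ∈ A) R fun s hs => ?_
  have hall : ∀ᵐ y ∂μ, ∀ x ∈ s, y ∈ A → R x y :=
    (Finset.eventually_all s).2 fun x hx => hR x (hs x hx)
  by_contra! hno
  refine hA (measure_mono_null (fun y hy => ?_) (ae_iff.1 hall))
  obtain ⟨x, hx, hxy⟩ := hno y hy
  exact fun h => hxy (h x hx hy)

theorem HypUE.exists_seq_lt_top {D : ℕ} {Λ : Set (EucD D)} {U : EucD D → EucD D → ℝ≥0∞}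
    (hU : HypUE D U Λ) (hΛne : Λ.Nonempty) (hΛopen : IsOpen Λ) :
    ∃ f : ℕ → EucD D, (∀ n, f n ∈ Λ) ∧ ∀ m n, m < n → U (f m) (f n) < ⊤ := by
  let E : ℕ → Set (EucD D) := fun n =>
    {x ∈ Λ | ∫⁻ y in Metric.ball x (1 / ((n : ℝ) + 1)) ∩ Λ, (U x y) ^ 2 < ⊤}
  have hE : Λ ⊆ ⋃ n, E n := by
    intro x hx
    obtain ⟨r, hr, hfin⟩ := hU.locL2 x hx
    obtain ⟨n, hn⟩ := exists_nat_one_div_lt hr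
    refine mem_iUnion.2 ⟨n, hx, (lintegral_mono_set ?_).trans_lt hfin⟩
    exact inter_subset_inter_left _ (Metric.ball_subset_ball hn.le)
  obtain ⟨n, hn⟩ : ∃ n, volume (E n) ≠ 0 := by
    by_contra! h
    exact (hΛopen.measure_pos volume hΛne).ne'
      (measure_mono_null hE (measure_iUnion_null h))
  set r : ℝ := 1 / ((n : ℝ) + 1) with hr
  have hrpos : 0 < r := by positivity
  obtain ⟨k, hk⟩ : ∃ k : ℕ,
      volume (E n ∩ Metric.ball (TopologicalSpace.denseSeq (EucD D) k) (r / 2)) ≠ 0 := by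
    by_contra! h
    refine hn (measure_mono_null (fun x hx => ?_) (measure_iUnion_null h))
    obtain ⟨k, hk⟩ := (TopologicalSpace.denseRange_denseSeq (EucD D)).exists_dist_lt x
      (half_pos hrpos)
    exact mem_iUnion.2 ⟨k, hx, hk⟩
  obtain ⟨f, hfA, hf⟩ := exists_seq_pairwise_of_ae hk (R := fun x y => U x y < ⊤) fun x hx => by
    have hxΛ : x ∈ closure Λ := subset_closure hx.1.1
    have hms : MeasurableSet (Metric.ball x r ∩ Λ) := Metric.isOpen_ball.measurableSet.inter
      hΛopen.measurableSet
    have hlsc : LowerSemicontinuous fun y : ↥(Metric.ball x r ∩ Λ) => U x y := by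
      have := hU.lsc.comp (g := fun y : EucD D => (x, y)) (t := Metric.ball x r ∩ Λ)
        (by fun_prop) fun y hy => ⟨hxΛ, subset_closure hy.2⟩
      exact lowerSemicontinuous_restrict_iff.2 this
    have hmeas : AEMeasurable (fun y => U x y) (volume.restrict (Metric.ball x r ∩ Λ)) :=
      (aemeasurable_restrict_iff_comap_subtype hms).2 hlsc.measurable.aemeasurable
    have hae := ae_lt_top' (hmeas.pow_const 2) hx.1.2.ne
    rw [ae_restrict_iff' hms] at hae
    filter_upwards [hae] with y hy hyA
    have hyball : y ∈ Metric.ball x r := by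
      rw [Metric.mem_ball, dist_comm]
      have h1 := Metric.mem_ball.1 hx.2
      have h2 := Metric.mem_ball'.1 hyA.2
      linarith [dist_triangle x (TopologicalSpace.denseSeq (EucD D) k) y]
    have := hy ⟨hyball, hyA.1.1⟩
    rw [ENNReal.pow_lt_top_iff] at this
    simpa using this
  exact ⟨f, fun m => (hfA m).1.1, hf⟩

theorem HypUE.minEnergy_ne_top {D : ℕ} {Λ : Set (EucD D)} {U : EucD D → EucD D → ℝ≥0∞}
    (hU : HypUE D U Λ) (hΛne : Λ.Nonempty) (hΛopen : IsOpen Λ) {N : ℕ} (hN : N ≠ 0) :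
    minEnergy (fun x y : closure Λ => U x y) N ≠ ⊤ := by
  obtain ⟨f, hfΛ, hf⟩ := hU.exists_seq_lt_top hΛne hΛopen
  refine ((iInf_le _ fun i : Fin N => (⟨f i, subset_closure (hfΛ i)⟩ : closure Λ)).trans_lt
    (ENNReal.div_lt_top ?_ (pow_ne_zero _ (Nat.cast_ne_zero.2 hN)))).ne
  refine ENNReal.sum_ne_top.2 fun i _ => ENNReal.sum_ne_top.2 fun j _ => ?_
  split_ifs with h
  · exact (hf i j h).ne
  · simp

theorem statement17
    (Λ : Set (EucD D)) (hΛne : Λ.Nonempty) (hΛopen : IsOpen Λ)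
    (hΛbdd : Bornology.IsBounded Λ) (hΛconn : IsConnected Λ)
    (U : EucD D → EucD D → ℝ≥0∞) (hU : HypUE D U Λ) :
    (∀ N : ℕ, 2 ≤ N →
      (((N ^ 2 : ℕ) : ℝ≥0∞) / (((N + 1) * (N - 1) : ℕ) : ℝ≥0∞)) *
          quasiPairGroundEnergy D U Λ N ≤
        quasiPairGroundEnergy D U Λ (N + 1)) ∧
    (∀ N : ℕ, 2 ≤ N →
      quasiPairGroundEnergy D U Λ N ≤ quasiPairGroundEnergy D U Λ (N + 1)) ∧
    (∀ N : ℕ, 2 ≤ N → 0 < quasiPairGroundEnergy D U Λ N →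
      quasiPairGroundEnergy D U Λ N < quasiPairGroundEnergy D U Λ (N + 1)) ∧
    Tendsto (fun N : ℕ => quasiPairGroundEnergy D U Λ N) atTop
      (nhds (groundEnergyE D U Λ)) := by
  have hsymm : ∀ x y : closure Λ, U x y = U y x := fun x y => hU.symm x x.2 y y.2
  have hlsc : LowerSemicontinuous fun p : closure Λ × closure Λ => U p.1 p.2 := by
    have := hU.lsc.comp (g := fun p : closure Λ × closure Λ => ((p.1 : EucD D), (p.2 : EucD D)))
      (t := univ) (by fun_prop) fun p _ => ⟨p.1.2, p.2.2⟩
    exact lowerSemicontinuousOn_univ_iff.1 this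
  have hcomp : CompactSpace (closure Λ) :=
    isCompact_iff_compactSpace.1 hΛbdd.isCompact_closure
  simp only [quasiPairGroundEnergy_eq_minEnergy, groundEnergyE_eq_iInf]
  refine ⟨fun N hN => ratio_mul_minEnergy_le _ hN, fun N hN => minEnergy_le_succ _ hN,
    fun N hN hpos => minEnergy_lt_succ _ hN hpos ?_, tendsto_minEnergy hlsc hsymm⟩
  exact hU.minEnergy_ne_top hΛne hΛopen (by omega)
end
end
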